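/- arXiv:2602.10788 — 2 statements merged into one kernel-verified Lean document; each statement's English description precedes it below -/
import Mathlib

section
/- Let λ₁, λ₂, μ₁, μ₂ ∈ ℝ and assume λ₁ > 0 or λ₂ > 0 (the two lowest weights are not both nonpositive). There exist a g-module E on which both (h,0) and (0,h) act semisimply, an injective g-module homomorphism i : V(λ₁,λ₂) → E, and a surjective g-module homomorphism p : E → V(μ₁,μ₂) with range(i) = ker(p), admitting no g-module homomorphism s : V(μ₁,μ₂) → E with p ∘ s = id, if and only if either (λ₁ is an integer with λ₁ ≤ 0, μ₁ = 2−λ₁ and μ₂ = λ₂) or (λ₂ is an integer with λ₂ ≤ 0, μ₂ = 2−λ₂ and μ₁ = λ₁). -/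
/-!
Context: g = sl₂ × sl₂.  For λ₁, λ₂ ∈ ℝ the lowest-weight g-module V(λ₁,λ₂) has
ℂ-basis {w_{j,k}}_{j,k∈ℕ} with
(e,0)·w_{j,k} = w_{j+1,k}, (h,0)·w_{j,k} = (λ₁+2j)·w_{j,k},
(f,0)·w_{j,k} = −j(λ₁+j−1)·w_{j−1,k}, and analogously for the second factor.
A g-module is encoded as a ℂ-module with six endomorphisms e₁,f₁,h₁,e₂,f₂,h₂
such that each triple satisfies the sl₂ relations and any operator from the first
triple commutes with any operator from the second.
-/

noncomputable section

universe u

/-- Carrier of `V(λ₁,λ₂)`: formal ℂ-combinations of basis vectors `w_{j,k}`. -/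
abbrev Verma2Carrier : Type := (ℕ × ℕ) →₀ ℂ

/-- Basis vector `w_{j,k}`. -/
def w2 (j k : ℕ) : Verma2Carrier := Finsupp.single (j, k) 1

/-- Action of `(e,0)`. -/
def vE1 : Verma2Carrier →ₗ[ℂ] Verma2Carrier :=
  Finsupp.lmapDomain ℂ ℂ fun p => (p.1 + 1, p.2)

/-- Action of `(h,0)`: `w_{j,k} ↦ (λ₁ + 2j) • w_{j,k}`. -/
def vH1 (l1 : ℝ) : Verma2Carrier →ₗ[ℂ] Verma2Carrier :=
  Finsupp.lsum ℂ fun p => (((l1 : ℂ)) + 2 * (p.1 : ℂ)) • Finsupp.lsingle p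

/-- Action of `(f,0)`: `w_{j,k} ↦ −j(λ₁+j−1) • w_{j−1,k}`. -/
def vF1 (l1 : ℝ) : Verma2Carrier →ₗ[ℂ] Verma2Carrier :=
  Finsupp.lsum ℂ fun p =>
    (-(p.1 : ℂ) * (((l1 : ℂ)) + (p.1 : ℂ) - 1)) • Finsupp.lsingle (p.1 - 1, p.2)

/-- Action of `(0,e)`. -/
def vE2 : Verma2Carrier →ₗ[ℂ] Verma2Carrier :=
  Finsupp.lmapDomain ℂ ℂ fun p => (p.1, p.2 + 1)

/-- Action of `(0,h)`: `w_{j,k} ↦ (λ₂ + 2k) • w_{j,k}`. -/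
def vH2 (l2 : ℝ) : Verma2Carrier →ₗ[ℂ] Verma2Carrier :=
  Finsupp.lsum ℂ fun p => (((l2 : ℂ)) + 2 * (p.2 : ℂ)) • Finsupp.lsingle p

/-- Action of `(0,f)`: `w_{j,k} ↦ −k(λ₂+k−1) • w_{j,k−1}`. -/
def vF2 (l2 : ℝ) : Verma2Carrier →ₗ[ℂ] Verma2Carrier :=
  Finsupp.lsum ℂ fun p =>
    (-(p.2 : ℂ) * (((l2 : ℂ)) + (p.2 : ℂ) - 1)) • Finsupp.lsingle (p.1, p.2 - 1)

/-- A module over `g = sl₂ × sl₂`. -/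
structure Sl2Sl2Module : Type (u + 1) where
  carrier : Type u
  [acg : AddCommGroup carrier]
  [mc : Module ℂ carrier]
  e1 : carrier →ₗ[ℂ] carrier
  f1 : carrier →ₗ[ℂ] carrier
  h1 : carrier →ₗ[ℂ] carrier
  e2 : carrier →ₗ[ℂ] carrier
  f2 : carrier →ₗ[ℂ] carrier
  h2 : carrier →ₗ[ℂ] carrier
  rel_he1 : h1 ∘ₗ e1 - e1 ∘ₗ h1 = (2 : ℂ) • e1
  rel_hf1 : h1 ∘ₗ f1 - f1 ∘ₗ h1 = (-2 : ℂ) • f1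
  rel_ef1 : e1 ∘ₗ f1 - f1 ∘ₗ e1 = h1
  rel_he2 : h2 ∘ₗ e2 - e2 ∘ₗ h2 = (2 : ℂ) • e2
  rel_hf2 : h2 ∘ₗ f2 - f2 ∘ₗ h2 = (-2 : ℂ) • f2
  rel_ef2 : e2 ∘ₗ f2 - f2 ∘ₗ e2 = h2
  comm_e1e2 : e1 ∘ₗ e2 = e2 ∘ₗ e1
  comm_e1f2 : e1 ∘ₗ f2 = f2 ∘ₗ e1
  comm_e1h2 : e1 ∘ₗ h2 = h2 ∘ₗ e1
  comm_f1e2 : f1 ∘ₗ e2 = e2 ∘ₗ f1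
  comm_f1f2 : f1 ∘ₗ f2 = f2 ∘ₗ f1
  comm_f1h2 : f1 ∘ₗ h2 = h2 ∘ₗ f1
  comm_h1e2 : h1 ∘ₗ e2 = e2 ∘ₗ h1
  comm_h1f2 : h1 ∘ₗ f2 = f2 ∘ₗ h1
  comm_h1h2 : h1 ∘ₗ h2 = h2 ∘ₗ h1

attribute [instance] Sl2Sl2Module.acg Sl2Sl2Module.mc

set_option linter.unusedSimpArgs false

/-! ### Basis formulas -/

theorem vE1_single (j k : ℕ) (c : ℂ) :
    vE1 (Finsupp.single (j, k) c) = Finsupp.single (j + 1, k) c := by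
  simp [vE1, Finsupp.lmapDomain_apply, Finsupp.mapDomain_single]

theorem vE2_single (j k : ℕ) (c : ℂ) :
    vE2 (Finsupp.single (j, k) c) = Finsupp.single (j, k + 1) c := by
  simp [vE2, Finsupp.lmapDomain_apply, Finsupp.mapDomain_single]

theorem vH1_single (l : ℝ) (j k : ℕ) (c : ℂ) :
    vH1 l (Finsupp.single (j, k) c) = Finsupp.single (j, k) (((l : ℂ) + 2 * j) * c) := by
  simp [vH1]

theorem vH2_single (l : ℝ) (j k : ℕ) (c : ℂ) :
    vH2 l (Finsupp.single (j, k) c) = Finsupp.single (j, k) (((l : ℂ) + 2 * k) * c) := by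
  simp [vH2]

theorem vF1_single (l : ℝ) (j k : ℕ) (c : ℂ) :
    vF1 l (Finsupp.single (j, k) c) =
      Finsupp.single (j - 1, k) ((-(j : ℂ) * ((l : ℂ) + j - 1)) * c) := by
  simp only [vF1, Finsupp.lsum_single, LinearMap.smul_apply, Finsupp.lsingle_apply,
    Finsupp.smul_single, smul_eq_mul]

theorem vF2_single (l : ℝ) (j k : ℕ) (c : ℂ) :
    vF2 l (Finsupp.single (j, k) c) =
      Finsupp.single (j, k - 1) ((-(k : ℂ) * ((l : ℂ) + k - 1)) * c) := by
  simp only [vF2, Finsupp.lsum_single, LinearMap.smul_apply, Finsupp.lsingle_apply,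
    Finsupp.smul_single, smul_eq_mul]

theorem vH1_apply (l : ℝ) (x : Verma2Carrier) (q : ℕ × ℕ) :
    vH1 l x q = ((l : ℂ) + 2 * q.1) * x q := by
  induction x using Finsupp.induction_linear with
  | zero => simp
  | add x y hx hy => simp [hx, hy, mul_add]
  | single r c =>
    obtain ⟨j, k⟩ := r
    rw [vH1_single]
    by_cases h : (j, k) = q
    · subst h; simp
    · simp [Finsupp.single_eq_of_ne' h]

theorem vH2_apply (l : ℝ) (x : Verma2Carrier) (q : ℕ × ℕ) :
    vH2 l x q = ((l : ℂ) + 2 * q.2) * x q := by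
  induction x using Finsupp.induction_linear with
  | zero => simp
  | add x y hx hy => simp [hx, hy, mul_add]
  | single r c =>
    obtain ⟨j, k⟩ := r
    rw [vH2_single]
    by_cases h : (j, k) = q
    · subst h; simp
    · simp [Finsupp.single_eq_of_ne' h]

/-- The coefficients of `f₁ x`. -/
theorem vF1_apply (l : ℝ) (x : Verma2Carrier) (j k : ℕ) :
    vF1 l x (j, k) = -((j : ℂ) + 1) * ((l : ℂ) + j) * x (j + 1, k) := by
  induction x using Finsupp.induction_linear with
  | zero => simp
  | add x y hx hy => simp [hx, hy, mul_add]
  | single r c =>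
    obtain ⟨a, b⟩ := r
    rw [vF1_single]
    rcases a with _ | a
    · simp
    · by_cases h : a = j ∧ b = k
      · obtain ⟨rfl, rfl⟩ := h
        simp only [Finsupp.single_eq_same, Nat.add_sub_cancel]
        push_cast
        ring
      · simp only [Finsupp.single_apply, Prod.mk.injEq, Nat.add_sub_cancel, add_left_inj, if_neg h]
        ring

theorem vF2_apply (l : ℝ) (x : Verma2Carrier) (j k : ℕ) :
    vF2 l x (j, k) = -((k : ℂ) + 1) * ((l : ℂ) + k) * x (j, k + 1) := by
  induction x using Finsupp.induction_linear with
  | zero => simp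
  | add x y hx hy => simp [hx, hy, mul_add]
  | single r c =>
    obtain ⟨a, b⟩ := r
    rw [vF2_single]
    rcases b with _ | b
    · simp
    · by_cases h : a = j ∧ b = k
      · obtain ⟨rfl, rfl⟩ := h
        simp only [Finsupp.single_eq_same, Nat.add_sub_cancel]
        push_cast
        ring
      · simp only [Finsupp.single_apply, Prod.mk.injEq, Nat.add_sub_cancel, add_left_inj, if_neg h]
        ring

/-- A vector of a given weight is a multiple of the basis vector of that weight. -/
theorem weight_eq_single {l1 l2 : ℝ} {c1 c2 : ℂ} {x : Verma2Carrier}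
    (h1 : vH1 l1 x = c1 • x) (h2 : vH2 l2 x = c2 • x) {j k : ℕ}
    (hj : c1 = l1 + 2 * j) (hk : c2 = l2 + 2 * k) :
    x = Finsupp.single (j, k) (x (j, k)) := by
  ext ⟨a, b⟩
  by_cases hx : x (a, b) = 0
  · by_cases h : (j, k) = (a, b)
    · rw [h]; simp
    · rw [Finsupp.single_eq_of_ne' h, hx]
  · have e1 := DFunLike.congr_fun h1 (a, b)
    have e2 := DFunLike.congr_fun h2 (a, b)
    rw [vH1_apply, Finsupp.smul_apply, smul_eq_mul] at e1
    rw [vH2_apply, Finsupp.smul_apply, smul_eq_mul] at e2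
    have e1 := mul_right_cancel₀ hx e1
    have e2 := mul_right_cancel₀ hx e2
    rw [hj] at e1
    rw [hk] at e2
    have ha : (a : ℂ) = j := by simpa using e1
    have hb : (b : ℂ) = k := by simpa using e2
    have ha := Nat.cast_injective ha
    have hb := Nat.cast_injective hb
    subst ha hb
    simp

theorem weight_exists {l1 l2 : ℝ} {c1 c2 : ℂ} {x : Verma2Carrier}
    (h1 : vH1 l1 x = c1 • x) (h2 : vH2 l2 x = c2 • x) (hx : x ≠ 0) :
    ∃ j k : ℕ, c1 = l1 + 2 * j ∧ c2 = l2 + 2 * k := by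
  obtain ⟨⟨a, b⟩, hab⟩ := Finsupp.ne_iff.1 hx
  have e1 := DFunLike.congr_fun h1 (a, b)
  have e2 := DFunLike.congr_fun h2 (a, b)
  rw [vH1_apply, Finsupp.smul_apply, smul_eq_mul] at e1
  rw [vH2_apply, Finsupp.smul_apply, smul_eq_mul] at e2
  exact ⟨a, b, (mul_right_cancel₀ hab e1).symm, (mul_right_cancel₀ hab e2).symm⟩

/-! ### The cohomology computation -/

theorem cohom {l1 l2 m1 m2 : ℝ} (hpos : 0 < l1 ∨ 0 < l2)
    (hA : ¬((∃ n : ℕ, l1 = -(n : ℝ)) ∧ m1 = 2 - l1 ∧ m2 = l2))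
    (hB : ¬((∃ n : ℕ, l2 = -(n : ℝ)) ∧ m2 = 2 - l2 ∧ m1 = l1))
    {a b : Verma2Carrier}
    (ha1 : vH1 l1 a = ((m1 : ℂ) - 2) • a) (ha2 : vH2 l2 a = (m2 : ℂ) • a)
    (hb1 : vH1 l1 b = (m1 : ℂ) • b) (hb2 : vH2 l2 b = ((m2 : ℂ) - 2) • b)
    (hab : vF2 l2 a = vF1 l1 b) :
    ∃ x, vH1 l1 x = (m1 : ℂ) • x ∧ vH2 l2 x = (m2 : ℂ) • x ∧ vF1 l1 x = a ∧ vF2 l2 x = b := by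
  by_cases ha : a = 0
  · by_cases hb : b = 0
    · exact ⟨0, by simp [ha, hb]⟩
    obtain ⟨j, k, hj, hk⟩ := weight_exists hb1 hb2 hb
    have hbs := weight_eq_single hb1 hb2 hj hk
    set β := b (j, k) with hβ
    have hβ0 : β ≠ 0 := by
      intro h; rw [h] at hbs; simp at hbs; exact hb hbs
    subst ha
    have hF : vF1 l1 b = 0 := by rw [← hab]; simp
    have hjR : m1 = l1 + 2 * j := by exact_mod_cast hj
    have hk' : (m2 : ℂ) = l2 + 2 * ((k + 1 : ℕ) : ℂ) := by push_cast; linear_combination hk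
    have hkR : m2 = l2 + 2 * ((k + 1 : ℕ) : ℝ) := by exact_mod_cast hk'
    have key : ∀ j', j = j' + 1 → l1 + j' = 0 := by
      rintro j' rfl
      have := DFunLike.congr_fun hF (j', k)
      rw [vF1_apply, ← hβ] at this
      simp [hβ0] at this
      rcases this with h | h
      · exfalso
        have : ((j' : ℝ) + 1 : ℝ) = 0 := by
          have h2 : ((j' : ℂ) + 1 : ℂ) = 0 := by linear_combination -h
          exact_mod_cast h2
        exact absurd this (by positivity)
      · exact_mod_cast h
    have hl : l2 + k ≠ 0 := by
      intro h
      have hl1 : 0 < l1 := hpos.resolve_right (by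
        have : (0 : ℝ) ≤ k := by positivity
        linarith)
      rcases j with _ | j
      · apply hB
        refine ⟨⟨k, by linarith⟩, ?_, ?_⟩
        · rw [hkR]; push_cast; linarith
        · simpa using hjR
      · have := key j rfl
        have : (0 : ℝ) ≤ j := by positivity
        linarith
    have hlC : (l2 : ℂ) + k ≠ 0 := by exact_mod_cast hl
    have hk1 : (k : ℂ) + 1 ≠ 0 := by exact_mod_cast Nat.succ_ne_zero k
    refine ⟨Finsupp.single (j, k + 1) (-β / ((k + 1) * (l2 + k))), ?_, ?_, ?_, ?_⟩
    · rw [vH1_single, Finsupp.smul_single, smul_eq_mul, hj]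
    · rw [vH2_single, Finsupp.smul_single, smul_eq_mul, hk']
    · rw [vF1_single]
      rcases j with _ | j
      · simp
      · have := key j rfl
        have : (l1 : ℂ) + j = 0 := by exact_mod_cast this
        have : (l1 : ℂ) + ((j + 1 : ℕ) : ℂ) - 1 = 0 := by push_cast; linear_combination this
        rw [this]; simp
    · rw [vF2_single, hbs]
      congr 1
      push_cast
      field_simp
      ring
  · obtain ⟨j, k, hj, hk⟩ := weight_exists ha1 ha2 ha
    have has := weight_eq_single ha1 ha2 hj hk
    set α := a (j, k) with hα
    have hα0 : α ≠ 0 := by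
      intro h; rw [h] at has; simp at has; exact ha has
    have hkR : m2 = l2 + 2 * k := by exact_mod_cast hk
    have hj' : (m1 : ℂ) = l1 + 2 * ((j + 1 : ℕ) : ℂ) := by push_cast; linear_combination hj
    have hjR : m1 = l1 + 2 * ((j + 1 : ℕ) : ℝ) := by exact_mod_cast hj'
    have key : ∀ k', k = k' + 1 →
        ((k' : ℂ) + 1) * (l2 + k') * α = (j + 1) * (l1 + j) * b (j + 1, k') := by
      rintro k' rfl
      have := DFunLike.congr_fun hab (j, k')
      rw [vF1_apply, vF2_apply, ← hα] at this
      linear_combination -this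
    have hl : l1 + j ≠ 0 := by
      intro h
      have hl2 : 0 < l2 := hpos.resolve_left (by
        have : (0 : ℝ) ≤ j := by positivity
        linarith)
      rcases k with _ | k
      · apply hA
        refine ⟨⟨j, by linarith⟩, ?_, ?_⟩
        · rw [hjR]; push_cast; linarith
        · simpa using hkR
      · have := key k rfl
        have hC : (l1 : ℂ) + j = 0 := by exact_mod_cast h
        rw [hC] at this
        have h3 : (k : ℂ) + 1 ≠ 0 := by exact_mod_cast Nat.succ_ne_zero k
        have h4 : (l2 : ℂ) + k ≠ 0 := by
          have : l2 + k ≠ 0 := by positivity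
          exact_mod_cast this
        simp [h3, h4, hα0] at this
    have hlC : (l1 : ℂ) + j ≠ 0 := by exact_mod_cast hl
    have hj1 : (j : ℂ) + 1 ≠ 0 := by exact_mod_cast Nat.succ_ne_zero j
    refine ⟨Finsupp.single (j + 1, k) (-α / ((j + 1) * (l1 + j))), ?_, ?_, ?_, ?_⟩
    · rw [vH1_single, Finsupp.smul_single, smul_eq_mul, hj']
    · rw [vH2_single, Finsupp.smul_single, smul_eq_mul, hk]
    · rw [vF1_single, has]
      congr 1
      push_cast
      field_simp
      ring
    · rw [vF2_single]
      rcases k with _ | k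
      · have hb : b = 0 := by
          by_contra hb
          obtain ⟨j', k', h1, h2⟩ := weight_exists hb1 hb2 hb
          have : ((k' + 1 : ℕ) : ℂ) = 0 := by
            push_cast; push_cast at hk; linear_combination (hk - h2) / 2
          exact Nat.succ_ne_zero k' (by exact_mod_cast this)
        simp [hb]
      · have hbs := weight_eq_single hb1 hb2 (j := j + 1) (k := k) hj'
          (by rw [hk]; push_cast; ring)
        rw [hbs]
        simp only [Nat.add_sub_cancel]
        congr 1
        push_cast
        field_simp
        linear_combination key k rfl

/-! ### Weight lifting -/

theorem exists_poly {M : Type*} [AddCommGroup M] [Module ℂ M] (T : M →ₗ[ℂ] M)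
    (hT : Submodule.span ℂ {v : M | ∃ c : ℂ, T v = c • v} = ⊤) (c : ℂ) (v : M) :
    ∃ q : Polynomial ℂ, q.eval c = 1 ∧
      T (Polynomial.aeval T q v) = c • Polynomial.aeval T q v := by
  have hv : v ∈ Submodule.span ℂ {v : M | ∃ c : ℂ, T v = c • v} := by rw [hT]; trivial
  have comm : ∀ (q : Polynomial ℂ) (x : M),
      T (Polynomial.aeval T q x) = Polynomial.aeval T q (T x) := by
    intro q x
    have := congrArg (fun r => Polynomial.aeval T r x) (mul_comm Polynomial.X q)
    simpa using this
  induction hv using Submodule.span_induction with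
  | mem x hx =>
    obtain ⟨d, hd⟩ := hx
    by_cases h : d = c
    · subst h
      exact ⟨1, by simp, by simpa using hd⟩
    · have h' : c - d ≠ 0 := sub_ne_zero.2 (Ne.symm h)
      refine ⟨Polynomial.C (c - d)⁻¹ * (Polynomial.X - Polynomial.C d), by simp [h'], ?_⟩
      simp [hd, Module.algebraMap_end_apply]
  | zero => exact ⟨1, by simp, by simp⟩
  | add x y _ _ hx hy =>
    obtain ⟨q, hq, hq'⟩ := hx
    obtain ⟨r, hr, hr'⟩ := hy
    refine ⟨q * r, by simp [hq, hr], ?_⟩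
    have e1 : Polynomial.aeval T (q * r) x = Polynomial.aeval T r (Polynomial.aeval T q x) := by
      rw [mul_comm]; simp
    have e2 : Polynomial.aeval T (q * r) y = Polynomial.aeval T q (Polynomial.aeval T r y) := by
      simp
    rw [map_add, map_add, smul_add, e1, e2, comm r, comm q (Polynomial.aeval T r y), hq', hr',
      map_smul, map_smul]
  | smul a x _ hx =>
    obtain ⟨q, hq, hq'⟩ := hx
    exact ⟨q, hq, by rw [map_smul, map_smul, hq', smul_comm]⟩

theorem aeval_intertwine {M N : Type*} [AddCommGroup M] [Module ℂ M] [AddCommGroup N] [Module ℂ N]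
    (T : M →ₗ[ℂ] M) (S : N →ₗ[ℂ] N) (p : M →ₗ[ℂ] N) (h : ∀ x, p (T x) = S (p x))
    (q : Polynomial ℂ) (x : M) : p (Polynomial.aeval T q x) = Polynomial.aeval S q (p x) := by
  induction q using Polynomial.induction_on' generalizing x with
  | add a b ha hb => simp [ha, hb]
  | monomial n c =>
    induction n generalizing x with
    | zero => simp [Module.algebraMap_end_apply]
    | succ n ih =>
      have := ih (T x)
      simp only [Polynomial.aeval_monomial, Module.End.mul_apply, Module.algebraMap_end_apply,
        map_smul, pow_succ] at this ⊢
      rw [this, h]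

theorem aeval_eigen {N : Type*} [AddCommGroup N] [Module ℂ N]
    (S : N →ₗ[ℂ] N) (c : ℂ) (x : N) (h : S x = c • x) (q : Polynomial ℂ) :
    Polynomial.aeval S q x = q.eval c • x := by
  have := aeval_intertwine (c • (LinearMap.id : ℂ →ₗ[ℂ] ℂ)) S (LinearMap.toSpanSingleton ℂ N x)
    (by intro t; simp [h, smul_smul, mul_comm]) q 1
  have h2 : ∀ q : Polynomial ℂ, ∀ t : ℂ,
      Polynomial.aeval (c • (LinearMap.id : ℂ →ₗ[ℂ] ℂ)) q t = q.eval c * t := by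
    intro q t
    induction q using Polynomial.induction_on' with
    | add a b ha hb => simp [ha, hb, add_mul]
    | monomial n d =>
      have : ∀ n : ℕ, ((c • (LinearMap.id : ℂ →ₗ[ℂ] ℂ)) ^ n) t = c ^ n * t := by
        intro n
        induction n with
        | zero => simp
        | succ n ih => rw [pow_succ', Module.End.mul_apply, ih]; simp; ring
      simp [Polynomial.aeval_monomial, this, Module.algebraMap_end_apply, mul_assoc]
  rw [h2] at this
  simpa using this.symm

/-! ### One `sl₂` -/

theorem sl2_h {M : Type*} [AddCommGroup M] [Module ℂ M] (e h : M →ₗ[ℂ] M)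
    (he : h ∘ₗ e - e ∘ₗ h = (2 : ℂ) • e)
    (m : ℂ) (u : M) (hu : h u = m • u) (j : ℕ) : h ((e ^ j) u) = (m + 2 * j) • (e ^ j) u := by
  induction j with
  | zero => simp [hu]
  | succ j ih =>
    have := LinearMap.congr_fun he ((e ^ j) u)
    simp only [LinearMap.sub_apply, LinearMap.comp_apply, LinearMap.smul_apply] at this
    rw [ih, map_smul, sub_eq_iff_eq_add] at this
    rw [pow_succ', Module.End.mul_apply, this]
    push_cast
    module

theorem sl2_f {M : Type*} [AddCommGroup M] [Module ℂ M] (e f h : M →ₗ[ℂ] M)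
    (he : h ∘ₗ e - e ∘ₗ h = (2 : ℂ) • e) (ef : e ∘ₗ f - f ∘ₗ e = h)
    (m : ℂ) (u : M) (hu : h u = m • u) (fu : f u = 0) (j : ℕ) :
    f ((e ^ j) u) = (-(j : ℂ) * (m + j - 1)) • (e ^ (j - 1)) u := by
  induction j with
  | zero => simp [fu]
  | succ j ih =>
    have := LinearMap.congr_fun ef ((e ^ j) u)
    simp only [LinearMap.sub_apply, LinearMap.comp_apply] at this
    rw [ih, map_smul, sl2_h e h he m u hu, sub_eq_iff_eq_add] at this
    have h2 : (-(j : ℂ) * (m + j - 1)) • e ((e ^ (j - 1)) u) =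
        (-(j : ℂ) * (m + j - 1)) • (e ^ j) u := by
      rcases j with _ | j
      · simp
      · rw [Nat.add_sub_cancel, pow_succ', Module.End.mul_apply]
    rw [h2, ← sub_eq_iff_eq_add'] at this
    rw [Nat.add_sub_cancel, pow_succ', Module.End.mul_apply, ← this]
    push_cast
    module

theorem comm_pow {M : Type*} [AddCommGroup M] [Module ℂ M] {a b : M →ₗ[ℂ] M}
    (h : a ∘ₗ b = b ∘ₗ a) (n : ℕ) (x : M) : a ((b ^ n) x) = (b ^ n) (a x) := by
  have : Commute a b := h
  exact LinearMap.congr_fun (this.pow_right n).eq x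

/-- A singular vector over `w_{0,0}` gives a splitting. -/
theorem splitting (E : Sl2Sl2Module.{u}) (p : E.carrier →ₗ[ℂ] Verma2Carrier) (m1 m2 : ℝ)
    (hp1 : p ∘ₗ E.e1 = vE1 ∘ₗ p) (hp2 : p ∘ₗ E.e2 = vE2 ∘ₗ p)
    (v : E.carrier) (hv1 : E.h1 v = (m1 : ℂ) • v) (hv2 : E.h2 v = (m2 : ℂ) • v)
    (fv1 : E.f1 v = 0) (fv2 : E.f2 v = 0) (pv : p v = Finsupp.single (0, 0) 1) :
    ∃ s : Verma2Carrier →ₗ[ℂ] E.carrier,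
            s ∘ₗ vE1 = E.e1 ∘ₗ s ∧ s ∘ₗ vF1 m1 = E.f1 ∘ₗ s ∧ s ∘ₗ vH1 m1 = E.h1 ∘ₗ s ∧
            s ∘ₗ vE2 = E.e2 ∘ₗ s ∧ s ∘ₗ vF2 m2 = E.f2 ∘ₗ s ∧ s ∘ₗ vH2 m2 = E.h2 ∘ₗ s ∧
            p ∘ₗ s = LinearMap.id := by
  let s : Verma2Carrier →ₗ[ℂ] E.carrier :=
    Finsupp.linearCombination ℂ fun q : ℕ × ℕ => (E.e1 ^ q.1) ((E.e2 ^ q.2) v)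
  have hs : ∀ j k c, s (Finsupp.single (j, k) c) = c • (E.e1 ^ j) ((E.e2 ^ k) v) := by
    intro j k c; simp [s]
  have hsw : ∀ j k, (E.e1 ^ j) ((E.e2 ^ k) v) = (E.e2 ^ k) ((E.e1 ^ j) v) := by
    intro j k
    have : Commute E.e1 E.e2 := E.comm_e1e2
    exact LinearMap.congr_fun (this.pow_pow j k).eq v
  have A1 : ∀ k, E.h1 ((E.e2 ^ k) v) = (m1 : ℂ) • (E.e2 ^ k) v := by
    intro k; rw [comm_pow E.comm_h1e2, hv1, map_smul]
  have A2 : ∀ k, E.f1 ((E.e2 ^ k) v) = 0 := by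
    intro k; rw [comm_pow E.comm_f1e2, fv1, map_zero]
  have B1 : ∀ j, E.h2 ((E.e1 ^ j) v) = (m2 : ℂ) • (E.e1 ^ j) v := by
    intro k; rw [comm_pow E.comm_e1h2.symm, hv2, map_smul]
  have B2 : ∀ j, E.f2 ((E.e1 ^ j) v) = 0 := by
    intro k; rw [comm_pow E.comm_e1f2.symm, fv2, map_zero]
  have P2 : ∀ k, p ((E.e2 ^ k) v) = Finsupp.single (0, k) 1 := by
    intro k
    induction k with
    | zero => simpa using pv
    | succ k ih =>
      rw [pow_succ', Module.End.mul_apply]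
      have := LinearMap.congr_fun hp2 ((E.e2 ^ k) v)
      simp only [LinearMap.comp_apply] at this
      rw [this, ih, vE2_single]
  have P1 : ∀ j k, p ((E.e1 ^ j) ((E.e2 ^ k) v)) = Finsupp.single (j, k) 1 := by
    intro j k
    induction j with
    | zero => simpa using P2 k
    | succ j ih =>
      rw [pow_succ', Module.End.mul_apply]
      have := LinearMap.congr_fun hp1 ((E.e1 ^ j) ((E.e2 ^ k) v))
      simp only [LinearMap.comp_apply] at this
      rw [this, ih, vE1_single]
  refine ⟨s, ?_, ?_, ?_, ?_, ?_, ?_, ?_⟩ <;> refine Finsupp.lhom_ext ?_ <;> rintro ⟨j, k⟩ c <;>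
    simp only [LinearMap.comp_apply]
  · rw [vE1_single, hs, hs, map_smul, pow_succ', Module.End.mul_apply]
  · rw [vF1_single, hs, hs, map_smul, sl2_f E.e1 E.f1 E.h1 E.rel_he1 E.rel_ef1 _ _ (A1 k) (A2 k),
      smul_smul, mul_comm]
  · rw [vH1_single, hs, hs, map_smul, sl2_h E.e1 E.h1 E.rel_he1 _ _ (A1 k), smul_smul, mul_comm]
  · rw [vE2_single, hs, hs, map_smul, hsw, hsw, pow_succ', Module.End.mul_apply]
  · rw [vF2_single, hs, hs, map_smul, hsw, hsw,
      sl2_f E.e2 E.f2 E.h2 E.rel_he2 E.rel_ef2 _ _ (B1 j) (B2 j), smul_smul, mul_comm]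
  · rw [vH2_single, hs, hs, map_smul, hsw, sl2_h E.e2 E.h2 E.rel_he2 _ _ (B1 j),
      smul_smul, mul_comm]
  · rw [hs, map_smul, P1]; simp

theorem forward (l1 l2 m1 m2 : ℝ) (hpos : 0 < l1 ∨ 0 < l2)
    (hA : ¬((∃ n : ℕ, l1 = -(n : ℝ)) ∧ m1 = 2 - l1 ∧ m2 = l2))
    (hB : ¬((∃ n : ℕ, l2 = -(n : ℝ)) ∧ m2 = 2 - l2 ∧ m1 = l1))
    (E : Sl2Sl2Module.{u})
    (i : Verma2Carrier →ₗ[ℂ] E.carrier) (p : E.carrier →ₗ[ℂ] Verma2Carrier)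
    (ss1 : Submodule.span ℂ {v : E.carrier | ∃ c : ℂ, E.h1 v = c • v} = ⊤)
    (ss2 : Submodule.span ℂ {v : E.carrier | ∃ c : ℂ, E.h2 v = c • v} = ⊤)
    (iF1 : i ∘ₗ vF1 l1 = E.f1 ∘ₗ i) (iH1 : i ∘ₗ vH1 l1 = E.h1 ∘ₗ i)
    (iF2 : i ∘ₗ vF2 l2 = E.f2 ∘ₗ i) (iH2 : i ∘ₗ vH2 l2 = E.h2 ∘ₗ i)
    (pE1 : p ∘ₗ E.e1 = vE1 ∘ₗ p) (pF1 : p ∘ₗ E.f1 = vF1 m1 ∘ₗ p)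
    (pH1 : p ∘ₗ E.h1 = vH1 m1 ∘ₗ p)
    (pE2 : p ∘ₗ E.e2 = vE2 ∘ₗ p) (pF2 : p ∘ₗ E.f2 = vF2 m2 ∘ₗ p)
    (pH2 : p ∘ₗ E.h2 = vH2 m2 ∘ₗ p)
    (inj : Function.Injective i) (surj : Function.Surjective p)
    (ex : LinearMap.range i = LinearMap.ker p) :
    ∃ s : Verma2Carrier →ₗ[ℂ] E.carrier,
            s ∘ₗ vE1 = E.e1 ∘ₗ s ∧ s ∘ₗ vF1 m1 = E.f1 ∘ₗ s ∧ s ∘ₗ vH1 m1 = E.h1 ∘ₗ s ∧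
            s ∘ₗ vE2 = E.e2 ∘ₗ s ∧ s ∘ₗ vF2 m2 = E.f2 ∘ₗ s ∧ s ∘ₗ vH2 m2 = E.h2 ∘ₗ s ∧
            p ∘ₗ s = LinearMap.id := by
  have iF1 := LinearMap.congr_fun iF1
  have iH1 := LinearMap.congr_fun iH1
  have iF2 := LinearMap.congr_fun iF2
  have iH2 := LinearMap.congr_fun iH2
  have pF1 := LinearMap.congr_fun pF1
  have pH1 := LinearMap.congr_fun pH1
  have pF2 := LinearMap.congr_fun pF2
  have pH2 := LinearMap.congr_fun pH2
  have ff := LinearMap.congr_fun E.comm_f1f2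
  have hh := LinearMap.congr_fun E.comm_h1h2
  have f1h2 := LinearMap.congr_fun E.comm_f1h2
  have h1f2 := LinearMap.congr_fun E.comm_h1f2
  have hf1 := LinearMap.congr_fun E.rel_hf1
  have hf2 := LinearMap.congr_fun E.rel_hf2
  simp only [LinearMap.comp_apply, LinearMap.sub_apply, LinearMap.smul_apply] at *
  -- a weight lift of `w_{0,0}`
  obtain ⟨v, hv1, hv2, pv⟩ : ∃ v, E.h1 v = (m1 : ℂ) • v ∧ E.h2 v = (m2 : ℂ) • v ∧
      p v = Finsupp.single (0, 0) 1 := by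
    obtain ⟨v0, hv0⟩ := surj (Finsupp.single (0, 0) 1)
    obtain ⟨q1, hq1, hq1'⟩ := exists_poly E.h1 ss1 m1 v0
    obtain ⟨q2, hq2, hq2'⟩ := exists_poly E.h2 ss2 m2 (Polynomial.aeval E.h1 q1 v0)
    refine ⟨_, ?_, hq2', ?_⟩
    · rw [aeval_intertwine E.h2 E.h2 E.h1 hh, hq1', map_smul]
    · rw [aeval_intertwine E.h2 (vH2 m2) p pH2, aeval_intertwine E.h1 (vH1 m1) p pH1, hv0,
        aeval_eigen (vH1 m1) m1 _ (by rw [vH1_single]; simp), hq1, one_smul,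
        aeval_eigen (vH2 m2) m2 _ (by rw [vH2_single]; simp), hq2, one_smul]
  obtain ⟨a, ha⟩ : E.f1 v ∈ LinearMap.range i := by
    rw [ex, LinearMap.mem_ker, pF1, pv, vF1_single]; simp
  obtain ⟨b, hb⟩ : E.f2 v ∈ LinearMap.range i := by
    rw [ex, LinearMap.mem_ker, pF2, pv, vF2_single]; simp
  obtain ⟨x, hx1, hx2, hxa, hxb⟩ := cohom (a := a) (b := b) hpos hA hB
    (by
      apply inj
      rw [iH1, ha, map_smul, ha]
      have := hf1 v
      rw [hv1, map_smul, sub_eq_iff_eq_add] at this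
      rw [this]; module)
    (by
      apply inj
      rw [iH2, ha, map_smul, ha, ← f1h2, hv2, map_smul])
    (by
      apply inj
      rw [iH1, hb, map_smul, hb, h1f2, hv1, map_smul])
    (by
      apply inj
      rw [iH2, hb, map_smul, hb]
      have := hf2 v
      rw [hv2, map_smul, sub_eq_iff_eq_add] at this
      rw [this]; module)
    (by
      apply inj
      rw [iF2, ha, iF1, hb, ff])
  refine splitting E p m1 m2 pE1 pE2 (v - i x) ?_ ?_ ?_ ?_ ?_
  · rw [map_sub, hv1, ← iH1, hx1, map_smul, smul_sub]
  · rw [map_sub, hv2, ← iH2, hx2, map_smul, smul_sub]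
  · rw [map_sub, ← ha, ← iF1, hxa, sub_self]
  · rw [map_sub, ← hb, ← iF2, hxb, sub_self]
  · have : i x ∈ LinearMap.ker p := by rw [← ex]; exact ⟨x, rfl⟩
    rw [map_sub, pv, LinearMap.mem_ker.1 this, sub_zero]

/-! ### Construction of the nonsplit extensions -/

/-- Shift by `n` in the first index. -/
def sh1 (n : ℕ) : Verma2Carrier →ₗ[ℂ] Verma2Carrier :=
  Finsupp.lmapDomain ℂ ℂ fun p => (p.1 + n, p.2)

/-- Shift by `n` in the second index. -/
def sh2 (n : ℕ) : Verma2Carrier →ₗ[ℂ] Verma2Carrier :=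
  Finsupp.lmapDomain ℂ ℂ fun p => (p.1, p.2 + n)

theorem sh1_single (n j k : ℕ) (c : ℂ) :
    sh1 n (Finsupp.single (j, k) c) = Finsupp.single (j + n, k) c := by
  simp [sh1, Finsupp.lmapDomain_apply, Finsupp.mapDomain_single]

theorem sh2_single (n j k : ℕ) (c : ℂ) :
    sh2 n (Finsupp.single (j, k) c) = Finsupp.single (j, k + n) c := by
  simp [sh2, Finsupp.lmapDomain_apply, Finsupp.mapDomain_single]

/-- Carrier of the extension. -/
abbrev ExtCarrier : Type u := ULift.{u} (Verma2Carrier × Verma2Carrier)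

/-- The operator `(x, y) ↦ (A x + C y, B y)`. -/
def blk (A C B : Verma2Carrier →ₗ[ℂ] Verma2Carrier) : ExtCarrier.{u} →ₗ[ℂ] ExtCarrier.{u} :=
  ULift.moduleEquiv.symm.toLinearMap ∘ₗ
    ((A ∘ₗ LinearMap.fst ℂ _ _ + C ∘ₗ LinearMap.snd ℂ _ _).prod (B ∘ₗ LinearMap.snd ℂ _ _)) ∘ₗ
    ULift.moduleEquiv.toLinearMap

theorem blk_apply (A C B : Verma2Carrier →ₗ[ℂ] Verma2Carrier) (x : ExtCarrier.{u}) :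
    blk A C B x = ULift.up (A x.down.1 + C x.down.2, B x.down.2) := rfl

theorem blk_comp (A C B A' C' B' : Verma2Carrier →ₗ[ℂ] Verma2Carrier) :
    blk.{u} A C B ∘ₗ blk.{u} A' C' B' = blk.{u} (A ∘ₗ A') (A ∘ₗ C' + C ∘ₗ B') (B ∘ₗ B') := by
  ext x : 1
  simp only [LinearMap.comp_apply, blk_apply, map_add, LinearMap.add_apply, add_assoc]

theorem blk_sub (A C B A' C' B' : Verma2Carrier →ₗ[ℂ] Verma2Carrier) :
    blk.{u} A C B - blk.{u} A' C' B' = blk.{u} (A - A') (C - C') (B - B') := by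
  ext x : 1
  apply ULift.down_injective
  simp only [LinearMap.sub_apply, blk_apply, ULift.sub_down]
  ext1
  · simp only [Prod.fst_sub]; abel
  · simp

theorem blk_sub0 (A B A' B' : Verma2Carrier →ₗ[ℂ] Verma2Carrier) :
    blk.{u} A 0 B - blk.{u} A' 0 B' = blk.{u} (A - A') 0 (B - B') := by
  have h : (0 : Verma2Carrier →ₗ[ℂ] Verma2Carrier) - 0 = 0 :=
    LinearMap.ext fun x => by simp only [LinearMap.sub_apply, LinearMap.zero_apply, sub_self]
  rw [blk_sub, h]

theorem blk_smul (c : ℂ) (A C B : Verma2Carrier →ₗ[ℂ] Verma2Carrier) :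
    c • blk.{u} A C B = blk.{u} (c • A) (c • C) (c • B) := by
  ext x : 1
  apply ULift.down_injective
  simp only [LinearMap.smul_apply, blk_apply, ULift.smul_down]
  ext1 <;> simp

/-- First inclusion. -/
def inc : Verma2Carrier →ₗ[ℂ] ExtCarrier.{u} :=
  ULift.moduleEquiv.symm.toLinearMap ∘ₗ LinearMap.inl ℂ _ _

/-- Second projection. -/
def prj : ExtCarrier.{u} →ₗ[ℂ] Verma2Carrier :=
  LinearMap.snd ℂ _ _ ∘ₗ ULift.moduleEquiv.toLinearMap

theorem inc_apply (x : Verma2Carrier) : inc.{u} x = ULift.up (x, 0) := rfl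

theorem prj_apply (x : ExtCarrier.{u}) : prj x = x.down.2 := rfl

theorem inc_blk (A C B : Verma2Carrier →ₗ[ℂ] Verma2Carrier) :
    inc.{u} ∘ₗ A = blk A C B ∘ₗ inc := by
  refine LinearMap.ext fun x => ?_
  simp [inc_apply, blk_apply]

theorem prj_blk (A C B : Verma2Carrier →ₗ[ℂ] Verma2Carrier) :
    prj.{u} ∘ₗ blk A C B = B ∘ₗ prj := by
  ext x : 1
  simp [prj_apply, blk_apply]

theorem inc_inj : Function.Injective inc.{u} := by
  intro x y h
  exact congrArg (fun z : ExtCarrier.{u} => z.down.1) h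

theorem prj_surj : Function.Surjective prj.{u} := fun y => ⟨ULift.up (0, y), rfl⟩

theorem inc_prj : LinearMap.range inc.{u} = LinearMap.ker prj.{u} := by
  ext x
  rw [LinearMap.mem_ker, LinearMap.mem_range, prj_apply]
  constructor
  · rintro ⟨y, rfl⟩; rfl
  · intro h
    refine ⟨x.down.1, ?_⟩
    apply ULift.down_injective
    rw [inc_apply]
    ext1
    · rfl
    · exact h.symm

theorem blk_span (A B : Verma2Carrier →ₗ[ℂ] Verma2Carrier)
    (hA : ∀ j k, ∃ c : ℂ, ∀ t : ℂ, A (Finsupp.single (j, k) t) = c • Finsupp.single (j, k) t)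
    (hB : ∀ j k, ∃ c : ℂ, ∀ t : ℂ, B (Finsupp.single (j, k) t) = c • Finsupp.single (j, k) t) :
    Submodule.span ℂ {v : ExtCarrier.{u} | ∃ c : ℂ, blk A 0 B v = c • v} = ⊤ := by
  rw [eq_top_iff]
  rintro ⟨x, y⟩ -
  have hx : ∀ x : Verma2Carrier, (ULift.up (x, 0) : ExtCarrier.{u}) ∈
      Submodule.span ℂ {v : ExtCarrier.{u} | ∃ c : ℂ, blk A 0 B v = c • v} := by
    intro x
    induction x using Finsupp.induction_linear with
    | zero => exact Submodule.zero_mem _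
    | add x y hx hy =>
      have e : (ULift.up (x + y, 0) : ExtCarrier.{u}) = ULift.up (x, 0) + ULift.up (y, 0) :=
        ULift.down_injective (by simp [ULift.add_down])
      rw [e]
      exact Submodule.add_mem _ hx hy
    | single r t =>
      apply Submodule.subset_span
      obtain ⟨c, hc⟩ := hA r.1 r.2
      refine ⟨c, ?_⟩
      apply ULift.down_injective
      rw [blk_apply, ULift.smul_down]
      ext1
      · simpa using hc t
      · simp
  have hy : ∀ x : Verma2Carrier, (ULift.up (0, x) : ExtCarrier.{u}) ∈
      Submodule.span ℂ {v : ExtCarrier.{u} | ∃ c : ℂ, blk A 0 B v = c • v} := by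
    intro x
    induction x using Finsupp.induction_linear with
    | zero => exact Submodule.zero_mem _
    | add x y hx hy =>
      have e : (ULift.up (0, x + y) : ExtCarrier.{u}) = ULift.up (0, x) + ULift.up (0, y) :=
        ULift.down_injective (by simp [ULift.add_down])
      rw [e]
      exact Submodule.add_mem _ hx hy
    | single r t =>
      apply Submodule.subset_span
      obtain ⟨c, hc⟩ := hB r.1 r.2
      refine ⟨c, ?_⟩
      apply ULift.down_injective
      rw [blk_apply, ULift.smul_down]
      ext1
      · simp
      · simpa using hc t
  have e : (ULift.up (x, y) : ExtCarrier.{u}) = ULift.up (x, 0) + ULift.up (0, y) :=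
    ULift.down_injective (by simp [ULift.add_down])
  rw [e]
  exact Submodule.add_mem _ (hx x) (hy y)

theorem r_he1 (l : ℝ) : vH1 l ∘ₗ vE1 - vE1 ∘ₗ vH1 l = (2 : ℂ) • vE1 := by
  refine Finsupp.lhom_ext ?_
  rintro ⟨j, k⟩ c
  simp only [LinearMap.sub_apply, LinearMap.comp_apply, LinearMap.smul_apply, vE1_single,
    vH1_single, Finsupp.smul_single, ← Finsupp.single_sub]
  congr 1
  push_cast
  simp only [smul_eq_mul]
  ring

theorem r_he2 (l : ℝ) : vH2 l ∘ₗ vE2 - vE2 ∘ₗ vH2 l = (2 : ℂ) • vE2 := by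
  refine Finsupp.lhom_ext ?_
  rintro ⟨j, k⟩ c
  simp only [LinearMap.sub_apply, LinearMap.comp_apply, LinearMap.smul_apply, vE2_single,
    vH2_single, Finsupp.smul_single, ← Finsupp.single_sub]
  congr 1
  push_cast
  simp only [smul_eq_mul]
  ring

theorem r_hf1 (l : ℝ) : vH1 l ∘ₗ vF1 l - vF1 l ∘ₗ vH1 l = (-2 : ℂ) • vF1 l := by
  refine Finsupp.lhom_ext ?_
  rintro ⟨j, k⟩ c
  simp only [LinearMap.sub_apply, LinearMap.comp_apply, LinearMap.smul_apply, vF1_single,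
    vH1_single, Finsupp.smul_single, ← Finsupp.single_sub]
  congr 1
  rcases j with _ | j
  · simp
  · push_cast [Nat.add_sub_cancel]
    simp only [smul_eq_mul]
    ring

theorem r_hf2 (l : ℝ) : vH2 l ∘ₗ vF2 l - vF2 l ∘ₗ vH2 l = (-2 : ℂ) • vF2 l := by
  refine Finsupp.lhom_ext ?_
  rintro ⟨j, k⟩ c
  simp only [LinearMap.sub_apply, LinearMap.comp_apply, LinearMap.smul_apply, vF2_single,
    vH2_single, Finsupp.smul_single, ← Finsupp.single_sub]
  congr 1
  rcases k with _ | k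
  · simp
  · push_cast [Nat.add_sub_cancel]
    simp only [smul_eq_mul]
    ring

theorem r_ef1 (l : ℝ) : vE1 ∘ₗ vF1 l - vF1 l ∘ₗ vE1 = vH1 l := by
  refine Finsupp.lhom_ext ?_
  rintro ⟨j, k⟩ c
  simp only [LinearMap.sub_apply, LinearMap.comp_apply, vF1_single, vE1_single, vH1_single,
    Nat.add_sub_cancel]
  rcases j with _ | j
  · simp [← Finsupp.single_neg]
  · simp only [Nat.add_sub_cancel, ← Finsupp.single_sub]
    congr 1
    push_cast
    ring

theorem r_ef2 (l : ℝ) : vE2 ∘ₗ vF2 l - vF2 l ∘ₗ vE2 = vH2 l := by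
  refine Finsupp.lhom_ext ?_
  rintro ⟨j, k⟩ c
  simp only [LinearMap.sub_apply, LinearMap.comp_apply, vF2_single, vE2_single, vH2_single,
    Nat.add_sub_cancel]
  rcases k with _ | k
  · simp [← Finsupp.single_neg]
  · simp only [Nat.add_sub_cancel, ← Finsupp.single_sub]
    congr 1
    push_cast
    ring

/-- The nonsplit extension in the first direction. -/
def ext1 (n : ℕ) (l1 l2 m1 : ℝ) (hl : l1 = -(n : ℝ)) (hm : m1 = 2 - l1) : Sl2Sl2Module.{u} where
  carrier := ExtCarrier.{u}
  e1 := blk vE1 0 vE1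
  f1 := blk (vF1 l1) (sh1 n) (vF1 m1)
  h1 := blk (vH1 l1) 0 (vH1 m1)
  e2 := blk vE2 0 vE2
  f2 := blk (vF2 l2) 0 (vF2 l2)
  h2 := blk (vH2 l2) 0 (vH2 l2)
  rel_he1 := by simp [blk_comp, blk_sub0, blk_smul, r_he1]
  rel_hf1 := by
    rw [blk_comp, blk_comp, blk_sub, blk_smul, r_hf1, r_hf1]
    congr 1
    refine Finsupp.lhom_ext ?_
    rintro ⟨j, k⟩ c
    simp only [LinearMap.add_apply, LinearMap.sub_apply, LinearMap.comp_apply,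
      LinearMap.smul_apply, LinearMap.zero_apply, map_zero, add_zero, zero_add, sh1_single,
      vH1_single, Finsupp.smul_single, ← Finsupp.single_sub]
    congr 1
    rw [hm, hl]
    push_cast
    simp only [smul_eq_mul]
    ring
  rel_ef1 := by
    rw [blk_comp, blk_comp, blk_sub, r_ef1, r_ef1]
    congr 1
    refine Finsupp.lhom_ext ?_
    rintro ⟨j, k⟩ c
    simp [sh1_single, vE1_single, Nat.add_right_comm]
  rel_he2 := by simp [blk_comp, blk_sub0, blk_smul, r_he2]
  rel_hf2 := by simp [blk_comp, blk_sub0, blk_smul, r_hf2]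
  rel_ef2 := by simp [blk_comp, blk_sub0, r_ef2]
  comm_e1e2 := by
    rw [blk_comp, blk_comp]
    congr 1 <;> refine Finsupp.lhom_ext ?_ <;> rintro ⟨j, k⟩ c <;> simp only [LinearMap.add_apply, LinearMap.comp_apply, LinearMap.zero_apply, map_zero,
        add_zero, zero_add, vE1_single, vE2_single]
  comm_e1f2 := by
    rw [blk_comp, blk_comp]
    congr 1 <;> refine Finsupp.lhom_ext ?_ <;> rintro ⟨j, k⟩ c <;> simp only [LinearMap.add_apply, LinearMap.comp_apply, LinearMap.zero_apply, map_zero,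
        add_zero, zero_add, vE1_single, vF2_single]
  comm_e1h2 := by
    rw [blk_comp, blk_comp]
    congr 1 <;> refine Finsupp.lhom_ext ?_ <;> rintro ⟨j, k⟩ c <;> simp only [LinearMap.add_apply, LinearMap.comp_apply, LinearMap.zero_apply, map_zero,
        add_zero, zero_add, vE1_single, vH2_single]
  comm_f1e2 := by
    rw [blk_comp, blk_comp]
    congr 1 <;> refine Finsupp.lhom_ext ?_ <;> rintro ⟨j, k⟩ c <;>
      simp only [LinearMap.add_apply, LinearMap.comp_apply, LinearMap.zero_apply, map_zero,
        add_zero, zero_add, vF1_single, vE2_single, sh1_single]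
  comm_f1f2 := by
    rw [blk_comp, blk_comp]
    congr 1 <;> refine Finsupp.lhom_ext ?_ <;> rintro ⟨j, k⟩ c <;>
      simp only [LinearMap.add_apply, LinearMap.comp_apply, LinearMap.zero_apply, map_zero,
        add_zero, zero_add, vF1_single, vF2_single, sh1_single] <;>
      congr 1 <;> ring
  comm_f1h2 := by
    rw [blk_comp, blk_comp]
    congr 1 <;> refine Finsupp.lhom_ext ?_ <;> rintro ⟨j, k⟩ c <;>
      simp only [LinearMap.add_apply, LinearMap.comp_apply, LinearMap.zero_apply, map_zero,
        add_zero, zero_add, vF1_single, vH2_single, sh1_single] <;>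
      congr 1 <;> ring
  comm_h1e2 := by
    rw [blk_comp, blk_comp]
    congr 1 <;> refine Finsupp.lhom_ext ?_ <;> rintro ⟨j, k⟩ c <;> simp only [LinearMap.add_apply, LinearMap.comp_apply, LinearMap.zero_apply, map_zero,
        add_zero, zero_add, vH1_single, vE2_single]
  comm_h1f2 := by
    rw [blk_comp, blk_comp]
    congr 1 <;> refine Finsupp.lhom_ext ?_ <;> rintro ⟨j, k⟩ c <;>
      simp only [LinearMap.add_apply, LinearMap.comp_apply, LinearMap.zero_apply, map_zero,
        add_zero, vH1_single, vF2_single] <;>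
      congr 1 <;> ring
  comm_h1h2 := by
    rw [blk_comp, blk_comp]
    congr 1 <;> refine Finsupp.lhom_ext ?_ <;> rintro ⟨j, k⟩ c <;>
      simp only [LinearMap.add_apply, LinearMap.comp_apply, LinearMap.zero_apply, map_zero,
        add_zero, vH1_single, vH2_single] <;>
      congr 1 <;> ring

/-- The nonsplit extension in the second direction. -/
def ext2 (n : ℕ) (l1 l2 m2 : ℝ) (hl : l2 = -(n : ℝ)) (hm : m2 = 2 - l2) : Sl2Sl2Module.{u} where
  carrier := ExtCarrier.{u}
  e1 := blk vE1 0 vE1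
  f1 := blk (vF1 l1) 0 (vF1 l1)
  h1 := blk (vH1 l1) 0 (vH1 l1)
  e2 := blk vE2 0 vE2
  f2 := blk (vF2 l2) (sh2 n) (vF2 m2)
  h2 := blk (vH2 l2) 0 (vH2 m2)
  rel_he2 := by simp [blk_comp, blk_sub0, blk_smul, r_he2]
  rel_hf2 := by
    rw [blk_comp, blk_comp, blk_sub, blk_smul, r_hf2, r_hf2]
    congr 1
    refine Finsupp.lhom_ext ?_
    rintro ⟨j, k⟩ c
    simp only [LinearMap.add_apply, LinearMap.sub_apply, LinearMap.comp_apply,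
      LinearMap.smul_apply, LinearMap.zero_apply, map_zero, add_zero, zero_add, sh2_single,
      vH2_single, Finsupp.smul_single, ← Finsupp.single_sub]
    congr 1
    rw [hm, hl]
    push_cast
    simp only [smul_eq_mul]
    ring
  rel_ef2 := by
    rw [blk_comp, blk_comp, blk_sub, r_ef2, r_ef2]
    congr 1
    refine Finsupp.lhom_ext ?_
    rintro ⟨j, k⟩ c
    simp [sh2_single, vE2_single, Nat.add_right_comm]
  rel_he1 := by simp [blk_comp, blk_sub0, blk_smul, r_he1]
  rel_hf1 := by simp [blk_comp, blk_sub0, blk_smul, r_hf1]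
  rel_ef1 := by simp [blk_comp, blk_sub0, r_ef1]
  comm_e1e2 := by
    rw [blk_comp, blk_comp]
    congr 1 <;> refine Finsupp.lhom_ext ?_ <;> rintro ⟨j, k⟩ c <;> simp only [LinearMap.add_apply, LinearMap.comp_apply, LinearMap.zero_apply, map_zero,
        add_zero, zero_add, vE1_single, vE2_single]
  comm_e1f2 := by
    rw [blk_comp, blk_comp]
    congr 1 <;> refine Finsupp.lhom_ext ?_ <;> rintro ⟨j, k⟩ c <;>
      simp only [LinearMap.add_apply, LinearMap.comp_apply, LinearMap.zero_apply, map_zero,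
        add_zero, zero_add, vE1_single, vF2_single, sh2_single]
  comm_e1h2 := by
    rw [blk_comp, blk_comp]
    congr 1 <;> refine Finsupp.lhom_ext ?_ <;> rintro ⟨j, k⟩ c <;> simp only [LinearMap.add_apply, LinearMap.comp_apply, LinearMap.zero_apply, map_zero,
        add_zero, zero_add, vE1_single, vH2_single]
  comm_f1e2 := by
    rw [blk_comp, blk_comp]
    congr 1 <;> refine Finsupp.lhom_ext ?_ <;> rintro ⟨j, k⟩ c <;>
      simp only [LinearMap.add_apply, LinearMap.comp_apply, LinearMap.zero_apply, map_zero,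
        add_zero, zero_add, vF1_single, vE2_single]
  comm_f1f2 := by
    rw [blk_comp, blk_comp]
    congr 1 <;> refine Finsupp.lhom_ext ?_ <;> rintro ⟨j, k⟩ c <;>
      simp only [LinearMap.add_apply, LinearMap.comp_apply, LinearMap.zero_apply, map_zero,
        add_zero, zero_add, vF1_single, vF2_single, sh2_single] <;>
      congr 1 <;> ring
  comm_f1h2 := by
    rw [blk_comp, blk_comp]
    congr 1 <;> refine Finsupp.lhom_ext ?_ <;> rintro ⟨j, k⟩ c <;>
      simp only [LinearMap.add_apply, LinearMap.comp_apply, LinearMap.zero_apply, map_zero,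
        add_zero, zero_add, vF1_single, vH2_single] <;>
      congr 1 <;> ring
  comm_h1e2 := by
    rw [blk_comp, blk_comp]
    congr 1 <;> refine Finsupp.lhom_ext ?_ <;> rintro ⟨j, k⟩ c <;> simp only [LinearMap.add_apply, LinearMap.comp_apply, LinearMap.zero_apply, map_zero,
        add_zero, zero_add, vH1_single, vE2_single]
  comm_h1f2 := by
    rw [blk_comp, blk_comp]
    congr 1 <;> refine Finsupp.lhom_ext ?_ <;> rintro ⟨j, k⟩ c <;>
      simp only [LinearMap.add_apply, LinearMap.comp_apply, LinearMap.zero_apply, map_zero,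
        add_zero, zero_add, vH1_single, vF2_single, sh2_single] <;>
      congr 1 <;> ring
  comm_h1h2 := by
    rw [blk_comp, blk_comp]
    congr 1 <;> refine Finsupp.lhom_ext ?_ <;> rintro ⟨j, k⟩ c <;>
      simp only [LinearMap.add_apply, LinearMap.comp_apply, LinearMap.zero_apply, map_zero,
        add_zero, vH1_single, vH2_single] <;>
      congr 1 <;> ring

theorem vH1_eig (l : ℝ) (j k : ℕ) : ∃ c : ℂ, ∀ t : ℂ,
    vH1 l (Finsupp.single (j, k) t) = c • Finsupp.single (j, k) t :=
  ⟨l + 2 * j, fun t => by rw [vH1_single, Finsupp.smul_single, smul_eq_mul]⟩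

theorem vH2_eig (l : ℝ) (j k : ℕ) : ∃ c : ℂ, ∀ t : ℂ,
    vH2 l (Finsupp.single (j, k) t) = c • Finsupp.single (j, k) t :=
  ⟨l + 2 * k, fun t => by rw [vH2_single, Finsupp.smul_single, smul_eq_mul]⟩

theorem nonsplit1 (n : ℕ) (l1 m1 : ℝ) (hn : l1 = -(n : ℝ)) (z : ExtCarrier.{u})
    (h1 : z.down.2 = Finsupp.single (0, 0) 1)
    (h3 : (0 : ExtCarrier.{u}) = blk (vF1 l1) (sh1 n) (vF1 m1) z) : False := by
  rw [blk_apply, h1, sh1_single] at h3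
  have h4 := congrArg (fun z : ExtCarrier.{u} => z.down.1 (0 + n, 0)) h3
  simp [vF1_apply, hn] at h4

theorem nonsplit2 (n : ℕ) (l2 m2 : ℝ) (hn : l2 = -(n : ℝ)) (z : ExtCarrier.{u})
    (h1 : z.down.2 = Finsupp.single (0, 0) 1)
    (h3 : (0 : ExtCarrier.{u}) = blk (vF2 l2) (sh2 n) (vF2 m2) z) : False := by
  rw [blk_apply, h1, sh2_single] at h3
  have h4 := congrArg (fun z : ExtCarrier.{u} => z.down.1 (0, 0 + n)) h3
  simp [vF2_apply, hn] at h4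

theorem stmt5 (l1 l2 m1 m2 : ℝ) (hpos : 0 < l1 ∨ 0 < l2) :
    (∃ E : Sl2Sl2Module.{u},
      ∃ (i : Verma2Carrier →ₗ[ℂ] E.carrier) (p : E.carrier →ₗ[ℂ] Verma2Carrier),
        Submodule.span ℂ {v : E.carrier | ∃ c : ℂ, E.h1 v = c • v} = ⊤ ∧
        Submodule.span ℂ {v : E.carrier | ∃ c : ℂ, E.h2 v = c • v} = ⊤ ∧
        (i ∘ₗ vE1 = E.e1 ∘ₗ i ∧ i ∘ₗ vF1 l1 = E.f1 ∘ₗ i ∧ i ∘ₗ vH1 l1 = E.h1 ∘ₗ i ∧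
          i ∘ₗ vE2 = E.e2 ∘ₗ i ∧ i ∘ₗ vF2 l2 = E.f2 ∘ₗ i ∧ i ∘ₗ vH2 l2 = E.h2 ∘ₗ i) ∧
        (p ∘ₗ E.e1 = vE1 ∘ₗ p ∧ p ∘ₗ E.f1 = vF1 m1 ∘ₗ p ∧ p ∘ₗ E.h1 = vH1 m1 ∘ₗ p ∧
          p ∘ₗ E.e2 = vE2 ∘ₗ p ∧ p ∘ₗ E.f2 = vF2 m2 ∘ₗ p ∧ p ∘ₗ E.h2 = vH2 m2 ∘ₗ p) ∧
        Function.Injective i ∧ Function.Surjective p ∧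
        LinearMap.range i = LinearMap.ker p ∧
        ¬∃ s : Verma2Carrier →ₗ[ℂ] E.carrier,
            s ∘ₗ vE1 = E.e1 ∘ₗ s ∧ s ∘ₗ vF1 m1 = E.f1 ∘ₗ s ∧ s ∘ₗ vH1 m1 = E.h1 ∘ₗ s ∧
            s ∘ₗ vE2 = E.e2 ∘ₗ s ∧ s ∘ₗ vF2 m2 = E.f2 ∘ₗ s ∧ s ∘ₗ vH2 m2 = E.h2 ∘ₗ s ∧
            p ∘ₗ s = LinearMap.id) ↔
    (((∃ n : ℕ, l1 = -(n : ℝ)) ∧ m1 = 2 - l1 ∧ m2 = l2) ∨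
      ((∃ n : ℕ, l2 = -(n : ℝ)) ∧ m2 = 2 - l2 ∧ m1 = l1)) := by
  constructor
  · rintro ⟨E, i, p, ss1, ss2, ⟨-, iF1, iH1, -, iF2, iH2⟩, ⟨pE1, pF1, pH1, pE2, pF2, pH2⟩,
      inj, surj, ex, hns⟩
    by_contra hcon
    rw [not_or] at hcon
    exact hns (forward l1 l2 m1 m2 hpos hcon.1 hcon.2 E i p ss1 ss2 iF1 iH1 iF2 iH2
      pE1 pF1 pH1 pE2 pF2 pH2 inj surj ex)
  · rintro (⟨⟨n, hn⟩, hm, rfl⟩ | ⟨⟨n, hn⟩, hm, rfl⟩)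
    · refine ⟨ext1 n l1 m2 m1 hn hm, inc, prj, blk_span _ _ (vH1_eig _) (vH1_eig _),
        blk_span _ _ (vH2_eig _) (vH2_eig _),
        ⟨inc_blk _ _ _, inc_blk _ _ _, inc_blk _ _ _, inc_blk _ _ _, inc_blk _ _ _,
          inc_blk _ _ _⟩,
        ⟨prj_blk _ _ _, prj_blk _ _ _, prj_blk _ _ _, prj_blk _ _ _, prj_blk _ _ _,
          prj_blk _ _ _⟩, inc_inj, prj_surj, inc_prj, ?_⟩
      rintro ⟨s, -, hf, -, -, -, -, hps⟩
      have h1 := LinearMap.congr_fun hps (Finsupp.single (0, 0) 1)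
      have h2 := LinearMap.congr_fun hf (Finsupp.single (0, 0) 1)
      rw [LinearMap.comp_apply, LinearMap.comp_apply, vF1_single] at h2
      change (s (Finsupp.single (0, 0) 1) : ExtCarrier.{u}).down.2 = Finsupp.single (0, 0) 1 at h1
      have h3 : (0 : ExtCarrier.{u}) = blk (vF1 l1) (sh1 n) (vF1 m1) (s (Finsupp.single (0, 0) 1)) := by
        refine Eq.trans ?_ h2
        simp
        rfl
      exact nonsplit1 n l1 m1 hn _ h1 h3
    · refine ⟨ext2 n m1 l2 m2 hn hm, inc, prj, blk_span _ _ (vH1_eig _) (vH1_eig _),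
        blk_span _ _ (vH2_eig _) (vH2_eig _),
        ⟨inc_blk _ _ _, inc_blk _ _ _, inc_blk _ _ _, inc_blk _ _ _, inc_blk _ _ _,
          inc_blk _ _ _⟩,
        ⟨prj_blk _ _ _, prj_blk _ _ _, prj_blk _ _ _, prj_blk _ _ _, prj_blk _ _ _,
          prj_blk _ _ _⟩, inc_inj, prj_surj, inc_prj, ?_⟩
      rintro ⟨s, -, -, -, -, hf, -, hps⟩
      have h1 := LinearMap.congr_fun hps (Finsupp.single (0, 0) 1)
      have h2 := LinearMap.congr_fun hf (Finsupp.single (0, 0) 1)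
      rw [LinearMap.comp_apply, LinearMap.comp_apply, vF2_single] at h2
      change (s (Finsupp.single (0, 0) 1) : ExtCarrier.{u}).down.2 = Finsupp.single (0, 0) 1 at h1
      have h3 : (0 : ExtCarrier.{u}) = blk (vF2 l2) (sh2 n) (vF2 m2) (s (Finsupp.single (0, 0) 1)) := by
        refine Eq.trans ?_ h2
        simp
        rfl
      exact nonsplit2 n l2 m2 hn _ h1 h3

end
end

section
/- Each of the six operators E_h, F_h, H_h, E_v, F_v, H_v on R commutes with every operator P_{αα̇}, with every operator L_{αβ}, and with every operator L̄_{α̇β̇} (for all α, β, α̇, β̇ ∈ {1,2}). -/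
/-!
Context: R = ℂ[y₁¹, y₁², y₂¹, y₂², ȳ₁¹, ȳ₁², ȳ₂¹, ȳ₂²], a polynomial ring in eight
commuting variables.  Indices `i, α ∈ {1,2}` are modelled by `Fin 2` (0 ↔ 1, 1 ↔ 2);
`Sum.inl (i, α)` indexes `y_i^α` and `Sum.inr (i, α̇)` indexes `ȳ_i^{α̇}`.
-/

noncomputable section

open MvPolynomial

set_option linter.all false
set_option linter.unusedSimpArgs false
set_option linter.unusedTactic false
set_option linter.unreachableTactic false
set_option linter.unnecessarySeqFocus false

/-- Index type of the eight variables. -/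
abbrev Idx8 : Type := (Fin 2 × Fin 2) ⊕ (Fin 2 × Fin 2)

/-- The ring R. -/
abbrev R8 : Type := MvPolynomial Idx8 ℂ

/-- The variable `y_i^α`. -/
def yv (i a : Fin 2) : R8 := X (Sum.inl (i, a))

/-- The variable `ȳ_i^{α̇}`. -/
def ybv (i a : Fin 2) : R8 := X (Sum.inr (i, a))

/-- Lowered variables `y_{i1} = −y_i²`, `y_{i2} = y_i¹`. -/
def ylow (i : Fin 2) : Fin 2 → R8 := ![-(yv i 1), yv i 0]

/-- Lowered variables `ȳ_{i1} = −ȳ_i²`, `ȳ_{i2} = ȳ_i¹`. -/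
def yblow (i : Fin 2) : Fin 2 → R8 := ![-(ybv i 1), ybv i 0]

/-- The partial derivative `∂_{iα} = ∂/∂y_i^α` as a ℂ-linear endomorphism. -/
def dy (i a : Fin 2) : Module.End ℂ R8 := (pderiv (Sum.inl (i, a))).toLinearMap

/-- The partial derivative `∂̄_{iα̇} = ∂/∂ȳ_i^{α̇}`. -/
def dyb (i a : Fin 2) : Module.End ℂ R8 := (pderiv (Sum.inr (i, a))).toLinearMap

/-- Multiplication by a polynomial, as a ℂ-linear endomorphism. -/
def mulOp (p : R8) : Module.End ℂ R8 := LinearMap.mulLeft ℂ p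

/-- `ζ = y₁¹y₂² − y₁²y₂¹`. -/
def zeta : R8 := yv 0 0 * yv 1 1 - yv 0 1 * yv 1 0

/-- `ζ̄ = ȳ₁¹ȳ₂² − ȳ₁²ȳ₂¹`. -/
def zetab : R8 := ybv 0 0 * ybv 1 1 - ybv 0 1 * ybv 1 0

/-- `E_h = Σ_α y₁^α ∂_{2α} + Σ_{α̇} ȳ₁^{α̇} ∂̄_{2α̇}`. -/
def Eh : Module.End ℂ R8 :=
  (∑ a, mulOp (yv 0 a) * dy 1 a) + (∑ a, mulOp (ybv 0 a) * dyb 1 a)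

/-- `F_h = Σ_α y₂^α ∂_{1α} + Σ_{α̇} ȳ₂^{α̇} ∂̄_{1α̇}`. -/
def Fh : Module.End ℂ R8 :=
  (∑ a, mulOp (yv 1 a) * dy 0 a) + (∑ a, mulOp (ybv 1 a) * dyb 0 a)

/-- `H_h = Σ_α (y₁^α ∂_{1α} − y₂^α ∂_{2α}) + Σ_{α̇} (ȳ₁^{α̇} ∂̄_{1α̇} − ȳ₂^{α̇} ∂̄_{2α̇})`. -/
def Hh : Module.End ℂ R8 :=
  (∑ a, (mulOp (yv 0 a) * dy 0 a - mulOp (yv 1 a) * dy 1 a)) +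
    (∑ a, (mulOp (ybv 0 a) * dyb 0 a - mulOp (ybv 1 a) * dyb 1 a))

/-- `E_v` = multiplication by `ζ + ζ̄`. -/
def Ev : Module.End ℂ R8 := mulOp (zeta + zetab)

/-- `F_v = (∂_{21}∂_{12} − ∂_{22}∂_{11}) + (∂̄_{21}∂̄_{12} − ∂̄_{22}∂̄_{11})`. -/
def Fv : Module.End ℂ R8 :=
  (dy 1 0 * dy 0 1 - dy 1 1 * dy 0 0) + (dyb 1 0 * dyb 0 1 - dyb 1 1 * dyb 0 0)

/-- `H_v = Σ_{i,α} y_i^α ∂_{iα} + Σ_{i,α̇} ȳ_i^{α̇} ∂̄_{iα̇} + 4·id`. -/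
def Hv : Module.End ℂ R8 :=
  (∑ i, ∑ a, mulOp (yv i a) * dy i a) + (∑ i, ∑ a, mulOp (ybv i a) * dyb i a) +
    (4 : ℂ) • (1 : Module.End ℂ R8)

/-- `P_{αα̇} = Σ_i (y_{iα} ∂̄_{iα̇} + ȳ_{iα̇} ∂_{iα})` (with lowered variables). -/
def Pop (a ad : Fin 2) : Module.End ℂ R8 :=
  ∑ i, (mulOp (ylow i a) * dyb i ad + mulOp (yblow i ad) * dy i a)

/-- `L_{αβ} = Σ_i (y_{iα} ∂_{iβ} + y_{iβ} ∂_{iα})`. -/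
def Lop (a b : Fin 2) : Module.End ℂ R8 :=
  ∑ i, (mulOp (ylow i a) * dy i b + mulOp (ylow i b) * dy i a)

/-- `L̄_{α̇β̇} = Σ_i (ȳ_{iα̇} ∂̄_{iβ̇} + ȳ_{iβ̇} ∂̄_{iα̇})`. -/
def Lbop (a b : Fin 2) : Module.End ℂ R8 :=
  ∑ i, (mulOp (yblow i a) * dyb i b + mulOp (yblow i b) * dyb i a)

theorem pderiv_comm8 (i j : Idx8) (p : R8) :
    pderiv i (pderiv j p) = pderiv j (pderiv i p) := by
  have h : ⁅(pderiv i : Derivation ℂ R8 R8), (pderiv j : Derivation ℂ R8 R8)⁆ = 0 := by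
    apply MvPolynomial.derivation_ext
    intro k
    simp only [Derivation.commutator_apply, pderiv_X, Pi.single_apply]
    split_ifs <;> simp
  have h2 := congrArg (fun D : Derivation ℂ R8 R8 => D p) h
  simpa [Derivation.commutator_apply, sub_eq_zero] using h2

/-- Two derivations that commute on the variables commute. -/
theorem der_comm8 (D E : Derivation ℂ R8 R8) (h : ∀ k, D (E (X k)) = E (D (X k))) (p : R8) :
    D (E p) = E (D p) := by
  have h1 : ⁅D, E⁆ = 0 := by
    apply MvPolynomial.derivation_ext
    intro k
    simp [Derivation.commutator_apply, h]
  have h2 := congrArg (fun D : Derivation ℂ R8 R8 => D p) h1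
  simpa [Derivation.commutator_apply, sub_eq_zero] using h2

/-- A commutator identity of derivations can be checked on the variables. -/
theorem der_comm_add8 (D E G : Derivation ℂ R8 R8)
    (h : ∀ k, D (E (X k)) = E (D (X k)) + G (X k)) (p : R8) :
    D (E p) = E (D p) + G p := by
  have h1 : ⁅D, E⁆ = G := by
    apply MvPolynomial.derivation_ext
    intro k
    simp [Derivation.commutator_apply, h]
  have h2 := congrArg (fun D : Derivation ℂ R8 R8 => D p) h1
  simp only [Derivation.commutator_apply] at h2
  rw [← h2]; ring

/-- `P` as a derivation. -/
def Pd (a ad : Fin 2) : Derivation ℂ R8 R8 :=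
  ∑ i, (ylow i a • pderiv (Sum.inr (i, ad)) + yblow i ad • pderiv (Sum.inl (i, a)))

/-- `L` as a derivation. -/
def Ld (a b : Fin 2) : Derivation ℂ R8 R8 :=
  ∑ i, (ylow i a • pderiv (Sum.inl (i, b)) + ylow i b • pderiv (Sum.inl (i, a)))

/-- `L̄` as a derivation. -/
def Lbd (a b : Fin 2) : Derivation ℂ R8 R8 :=
  ∑ i, (yblow i a • pderiv (Sum.inr (i, b)) + yblow i b • pderiv (Sum.inr (i, a)))

/-- The operator `Σ y_i ∂_j + ȳ_i ∂̄_j`. -/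
def Gd (i j : Fin 2) : Derivation ℂ R8 R8 :=
  ∑ a, (yv i a • pderiv (Sum.inl (j, a)) + ybv i a • pderiv (Sum.inr (j, a)))

/-- The sign matrix. -/
def eps8 (a b : Fin 2) : R8 := if a = b then 0 else if a = 0 then 1 else -1

theorem Pop_apply (a b : Fin 2) (p : R8) : Pop a b p = Pd a b p := by
  simp [Pop, Pd, mulOp, dy, dyb, Fin.sum_univ_two]

theorem Lop_apply (a b : Fin 2) (p : R8) : Lop a b p = Ld a b p := by
  simp [Lop, Ld, mulOp, dy, Fin.sum_univ_two]

theorem Lbop_apply (a b : Fin 2) (p : R8) : Lbop a b p = Lbd a b p := by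
  simp [Lbop, Lbd, mulOp, dyb, Fin.sum_univ_two]

theorem Eh_apply (p : R8) : Eh p = Gd 0 1 p := by
  simp [Eh, Gd, mulOp, dy, dyb, Fin.sum_univ_two]; ring

theorem Fh_apply (p : R8) : Fh p = Gd 1 0 p := by
  simp [Fh, Gd, mulOp, dy, dyb, Fin.sum_univ_two]; ring

theorem Hh_apply (p : R8) : Hh p = Gd 0 0 p - Gd 1 1 p := by
  simp [Hh, Gd, mulOp, dy, dyb, Fin.sum_univ_two]; ring

theorem Hv_apply (p : R8) : Hv p = Gd 0 0 p + Gd 1 1 p + (4 : ℂ) • p := by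
  simp [Hv, Gd, mulOp, dy, dyb, Fin.sum_univ_two]; ring

theorem Ev_apply (p : R8) : Ev p = (zeta + zetab) * p := rfl

theorem Fv_apply (p : R8) : Fv p =
    (pderiv (Sum.inl (1, 0)) (pderiv (Sum.inl (0, 1)) p)
      - pderiv (Sum.inl (1, 1)) (pderiv (Sum.inl (0, 0)) p))
    + (pderiv (Sum.inr (1, 0)) (pderiv (Sum.inr (0, 1)) p)
      - pderiv (Sum.inr (1, 1)) (pderiv (Sum.inr (0, 0)) p)) := rfl

theorem Pd_X_inl (a b j c : Fin 2) :
    Pd a b (X (Sum.inl (j, c))) = yblow j b * (if a = c then 1 else 0) := by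
  fin_cases j <;> simp [Pd, Fin.sum_univ_two, pderiv_X, Pi.single_apply, eq_comm]

theorem Pd_X_inr (a b j c : Fin 2) :
    Pd a b (X (Sum.inr (j, c))) = ylow j a * (if b = c then 1 else 0) := by
  fin_cases j <;> simp [Pd, Fin.sum_univ_two, pderiv_X, Pi.single_apply, eq_comm]

theorem Ld_X_inl (a b j c : Fin 2) :
    Ld a b (X (Sum.inl (j, c))) = ylow j a * (if b = c then 1 else 0) + ylow j b * (if a = c then 1 else 0) := by
  fin_cases j <;> simp [Ld, Fin.sum_univ_two, pderiv_X, Pi.single_apply, eq_comm]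

theorem Ld_X_inr (a b j c : Fin 2) :
    Ld a b (X (Sum.inr (j, c))) = 0 := by
  fin_cases j <;> simp [Ld, Fin.sum_univ_two, pderiv_X, Pi.single_apply, eq_comm]

theorem Lbd_X_inl (a b j c : Fin 2) :
    Lbd a b (X (Sum.inl (j, c))) = 0 := by
  fin_cases j <;> simp [Lbd, Fin.sum_univ_two, pderiv_X, Pi.single_apply, eq_comm]

theorem Lbd_X_inr (a b j c : Fin 2) :
    Lbd a b (X (Sum.inr (j, c))) = yblow j a * (if b = c then 1 else 0) + yblow j b * (if a = c then 1 else 0) := by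
  fin_cases j <;> simp [Lbd, Fin.sum_univ_two, pderiv_X, Pi.single_apply, eq_comm]

theorem Gd_X_inl (i j k c : Fin 2) :
    Gd i j (X (Sum.inl (k, c))) = if j = k then yv i c else 0 := by
  fin_cases c <;> simp [Gd, Fin.sum_univ_two, pderiv_X, Pi.single_apply, eq_comm]

theorem Gd_X_inr (i j k c : Fin 2) :
    Gd i j (X (Sum.inr (k, c))) = if j = k then ybv i c else 0 := by
  fin_cases c <;> simp [Gd, Fin.sum_univ_two, pderiv_X, Pi.single_apply, eq_comm]

theorem Gd_ylow (i j k c : Fin 2) :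
    Gd i j (ylow k c) = if j = k then ylow i c else 0 := by
  fin_cases c <;> simp [ylow, yv, Gd_X_inl, Gd_X_inr] <;> split_ifs <;> simp

theorem Gd_yblow (i j k c : Fin 2) :
    Gd i j (yblow k c) = if j = k then yblow i c else 0 := by
  fin_cases c <;> simp [yblow, ybv, Gd_X_inl, Gd_X_inr] <;> split_ifs <;> simp

theorem Gd_Pd (i j a b : Fin 2) (p : R8) : Gd i j (Pd a b p) = Pd a b (Gd i j p) := by
  apply der_comm8
  rintro (⟨k, c⟩ | ⟨k, c⟩) <;>
  · simp only [Gd_X_inl, Gd_X_inr, Pd_X_inl, Pd_X_inr]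
    split_ifs <;> simp [Gd_ylow, Gd_yblow, yv, ybv, Pd_X_inl, Pd_X_inr, *]

theorem Pd_zeta (a b : Fin 2) : Pd a b (zeta + zetab) = 0 := by
  simp only [zeta, zetab, yv, ybv, map_add, map_sub, Derivation.leibniz, Pd_X_inl, Pd_X_inr]
  fin_cases a <;> fin_cases b <;> simp [ylow, yblow, yv, ybv] <;> ring

theorem Gd_Ld (i j a b : Fin 2) (p : R8) : Gd i j (Ld a b p) = Ld a b (Gd i j p) := by
  apply der_comm8
  rintro (⟨k, c⟩ | ⟨k, c⟩) <;>
  · simp only [Gd_X_inl, Gd_X_inr, Ld_X_inl, Ld_X_inr]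
    split_ifs <;> simp [Gd_ylow, Gd_yblow, yv, ybv, Ld_X_inl, Ld_X_inr, *]

theorem Ld_zeta (a b : Fin 2) : Ld a b (zeta + zetab) = 0 := by
  simp only [zeta, zetab, yv, ybv, map_add, map_sub, Derivation.leibniz, Ld_X_inl, Ld_X_inr]
  fin_cases a <;> fin_cases b <;> simp [ylow, yblow, yv, ybv] <;> ring

theorem Gd_Lbd (i j a b : Fin 2) (p : R8) : Gd i j (Lbd a b p) = Lbd a b (Gd i j p) := by
  apply der_comm8
  rintro (⟨k, c⟩ | ⟨k, c⟩) <;>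
  · simp only [Gd_X_inl, Gd_X_inr, Lbd_X_inl, Lbd_X_inr]
    split_ifs <;> simp [Gd_ylow, Gd_yblow, yv, ybv, Lbd_X_inl, Lbd_X_inr, *]

theorem Lbd_zeta (a b : Fin 2) : Lbd a b (zeta + zetab) = 0 := by
  simp only [zeta, zetab, yv, ybv, map_add, map_sub, Derivation.leibniz, Lbd_X_inl, Lbd_X_inr]
  fin_cases a <;> fin_cases b <;> simp [ylow, yblow, yv, ybv] <;> ring

theorem pderiv_inl_ylow (i a k b : Fin 2) :
    pderiv (Sum.inl (i, a)) (ylow k b) = if k = i then eps8 a b else 0 := by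
  fin_cases a <;> fin_cases b <;>
    simp [ylow, yv, ybv, pderiv_X, Pi.single_apply, eps8] <;> split_ifs <;> simp

theorem pderiv_inl_yblow (i a k b : Fin 2) :
    pderiv (Sum.inl (i, a)) (yblow k b) = 0 := by
  fin_cases a <;> fin_cases b <;>
    simp [yblow, yv, ybv, pderiv_X, Pi.single_apply, eps8] <;> split_ifs <;> simp

theorem pderiv_inr_ylow (i a k b : Fin 2) :
    pderiv (Sum.inr (i, a)) (ylow k b) = 0 := by
  fin_cases a <;> fin_cases b <;>
    simp [ylow, yv, ybv, pderiv_X, Pi.single_apply, eps8] <;> split_ifs <;> simp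

theorem pderiv_inr_yblow (i a k b : Fin 2) :
    pderiv (Sum.inr (i, a)) (yblow k b) = if k = i then eps8 a b else 0 := by
  fin_cases a <;> fin_cases b <;>
    simp [yblow, yv, ybv, pderiv_X, Pi.single_apply, eps8] <;> split_ifs <;> simp

theorem pderiv_inl_Pd (i a b c : Fin 2) (p : R8) :
    pderiv (Sum.inl (i, a)) (Pd b c p) = Pd b c (pderiv (Sum.inl (i, a)) p)
      + (eps8 a b • pderiv (Sum.inr (i, c)) : Derivation ℂ R8 R8) p := by
  apply der_comm_add8
  rintro (⟨k, d⟩ | ⟨k, d⟩) <;>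
  · simp only [Pd_X_inl, Pd_X_inr, pderiv_X, Pi.single_apply]
    by_cases hk : k = i <;> by_cases hb : b = d <;> by_cases hc : c = d <;>
      by_cases ha : d = a <;>
      simp [pderiv_X, Pi.single_apply, pderiv_inl_ylow, pderiv_inl_yblow, pderiv_inr_ylow,
        pderiv_inr_yblow, apply_ite (Pd b c), *] <;> simp_all [eq_comm]

theorem pderiv_inr_Pd (i a b c : Fin 2) (p : R8) :
    pderiv (Sum.inr (i, a)) (Pd b c p) = Pd b c (pderiv (Sum.inr (i, a)) p)
      + (eps8 a c • pderiv (Sum.inl (i, b)) : Derivation ℂ R8 R8) p := by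
  apply der_comm_add8
  rintro (⟨k, d⟩ | ⟨k, d⟩) <;>
  · simp only [Pd_X_inl, Pd_X_inr, pderiv_X, Pi.single_apply]
    by_cases hk : k = i <;> by_cases hb : b = d <;> by_cases hc : c = d <;>
      by_cases ha : d = a <;>
      simp [pderiv_X, Pi.single_apply, pderiv_inl_ylow, pderiv_inl_yblow, pderiv_inr_ylow,
        pderiv_inr_yblow, apply_ite (Pd b c), *] <;> simp_all [eq_comm]

theorem pderiv_inl_Ld (i a b c : Fin 2) (p : R8) :
    pderiv (Sum.inl (i, a)) (Ld b c p) = Ld b c (pderiv (Sum.inl (i, a)) p)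
      + (eps8 a b • pderiv (Sum.inl (i, c)) + eps8 a c • pderiv (Sum.inl (i, b)) : Derivation ℂ R8 R8) p := by
  apply der_comm_add8
  rintro (⟨k, d⟩ | ⟨k, d⟩) <;>
  · simp only [Ld_X_inl, Ld_X_inr, pderiv_X, Pi.single_apply]
    by_cases hk : k = i <;> by_cases hb : b = d <;> by_cases hc : c = d <;>
      by_cases ha : d = a <;>
      simp [pderiv_X, Pi.single_apply, pderiv_inl_ylow, pderiv_inl_yblow, pderiv_inr_ylow,
        pderiv_inr_yblow, apply_ite (Ld b c), *] <;> simp_all [eq_comm]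

theorem pderiv_inr_Ld (i a b c : Fin 2) (p : R8) :
    pderiv (Sum.inr (i, a)) (Ld b c p) = Ld b c (pderiv (Sum.inr (i, a)) p)
      + (0 : Derivation ℂ R8 R8) p := by
  apply der_comm_add8
  rintro (⟨k, d⟩ | ⟨k, d⟩) <;>
  · simp only [Ld_X_inl, Ld_X_inr, pderiv_X, Pi.single_apply]
    by_cases hk : k = i <;> by_cases hb : b = d <;> by_cases hc : c = d <;>
      by_cases ha : d = a <;>
      simp [pderiv_X, Pi.single_apply, pderiv_inl_ylow, pderiv_inl_yblow, pderiv_inr_ylow,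
        pderiv_inr_yblow, apply_ite (Ld b c), *] <;> simp_all [eq_comm]

theorem pderiv_inr_Lbd (i a b c : Fin 2) (p : R8) :
    pderiv (Sum.inr (i, a)) (Lbd b c p) = Lbd b c (pderiv (Sum.inr (i, a)) p)
      + (eps8 a b • pderiv (Sum.inr (i, c)) + eps8 a c • pderiv (Sum.inr (i, b)) : Derivation ℂ R8 R8) p := by
  apply der_comm_add8
  rintro (⟨k, d⟩ | ⟨k, d⟩) <;>
  · simp only [Lbd_X_inl, Lbd_X_inr, pderiv_X, Pi.single_apply]
    by_cases hk : k = i <;> by_cases hb : b = d <;> by_cases hc : c = d <;>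
      by_cases ha : d = a <;>
      simp [pderiv_X, Pi.single_apply, pderiv_inl_ylow, pderiv_inl_yblow, pderiv_inr_ylow,
        pderiv_inr_yblow, apply_ite (Lbd b c), *] <;> simp_all [eq_comm]

theorem pderiv_inl_Lbd (i a b c : Fin 2) (p : R8) :
    pderiv (Sum.inl (i, a)) (Lbd b c p) = Lbd b c (pderiv (Sum.inl (i, a)) p)
      + (0 : Derivation ℂ R8 R8) p := by
  apply der_comm_add8
  rintro (⟨k, d⟩ | ⟨k, d⟩) <;>
  · simp only [Lbd_X_inl, Lbd_X_inr, pderiv_X, Pi.single_apply]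
    by_cases hk : k = i <;> by_cases hb : b = d <;> by_cases hc : c = d <;>
      by_cases ha : d = a <;>
      simp [pderiv_X, Pi.single_apply, pderiv_inl_ylow, pderiv_inl_yblow, pderiv_inr_ylow,
        pderiv_inr_yblow, apply_ite (Lbd b c), *] <;> simp_all [eq_comm]

theorem Pd_comm_Fv (b c : Fin 2) (p : R8) : Fv (Pd b c p) = Pd b c (Fv p) := by
  simp only [Fv_apply, pderiv_inl_Pd, pderiv_inr_Pd, map_add, map_sub, Derivation.add_apply,
    Derivation.smul_apply, Derivation.zero_apply, add_zero]
  fin_cases b <;> fin_cases c <;> simp [eps8] <;>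
    simp only [pderiv_comm8 (Sum.inl (1, _)) (Sum.inl (0, _)),
      pderiv_comm8 (Sum.inr (1, _)) (Sum.inr (0, _)),
      pderiv_comm8 (Sum.inr _) (Sum.inl _)] <;> ring

theorem comm_all_Pd (A : Module.End ℂ R8)
    (hA : A ∈ ({Eh, Fh, Hh, Ev, Fv, Hv} : Set (Module.End ℂ R8))) (a b : Fin 2) (p : R8) :
    A (Pd a b p) = Pd a b (A p) := by
  simp only [Set.mem_insert_iff, Set.mem_singleton_iff] at hA
  rcases hA with rfl | rfl | rfl | rfl | rfl | rfl
  · simp only [Eh_apply, Gd_Pd]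
  · simp only [Fh_apply, Gd_Pd]
  · simp only [Hh_apply, Gd_Pd, map_sub]
  · simp only [Ev_apply, Derivation.leibniz, Pd_zeta, mul_zero, add_zero, smul_eq_mul]
  · exact Pd_comm_Fv a b p
  · simp only [Hv_apply, Gd_Pd, map_add, Derivation.map_smul]

theorem Ld_comm_Fv (b c : Fin 2) (p : R8) : Fv (Ld b c p) = Ld b c (Fv p) := by
  simp only [Fv_apply, pderiv_inl_Ld, pderiv_inr_Ld, map_add, map_sub, Derivation.add_apply,
    Derivation.smul_apply, Derivation.zero_apply, add_zero]
  fin_cases b <;> fin_cases c <;> simp [eps8] <;>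
    simp only [pderiv_comm8 (Sum.inl (1, _)) (Sum.inl (0, _)),
      pderiv_comm8 (Sum.inr (1, _)) (Sum.inr (0, _)),
      pderiv_comm8 (Sum.inr _) (Sum.inl _)] <;> ring

theorem comm_all_Ld (A : Module.End ℂ R8)
    (hA : A ∈ ({Eh, Fh, Hh, Ev, Fv, Hv} : Set (Module.End ℂ R8))) (a b : Fin 2) (p : R8) :
    A (Ld a b p) = Ld a b (A p) := by
  simp only [Set.mem_insert_iff, Set.mem_singleton_iff] at hA
  rcases hA with rfl | rfl | rfl | rfl | rfl | rfl
  · simp only [Eh_apply, Gd_Ld]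
  · simp only [Fh_apply, Gd_Ld]
  · simp only [Hh_apply, Gd_Ld, map_sub]
  · simp only [Ev_apply, Derivation.leibniz, Ld_zeta, mul_zero, add_zero, smul_eq_mul]
  · exact Ld_comm_Fv a b p
  · simp only [Hv_apply, Gd_Ld, map_add, Derivation.map_smul]

theorem Lbd_comm_Fv (b c : Fin 2) (p : R8) : Fv (Lbd b c p) = Lbd b c (Fv p) := by
  simp only [Fv_apply, pderiv_inl_Lbd, pderiv_inr_Lbd, map_add, map_sub, Derivation.add_apply,
    Derivation.smul_apply, Derivation.zero_apply, add_zero]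
  fin_cases b <;> fin_cases c <;> simp [eps8] <;>
    simp only [pderiv_comm8 (Sum.inl (1, _)) (Sum.inl (0, _)),
      pderiv_comm8 (Sum.inr (1, _)) (Sum.inr (0, _)),
      pderiv_comm8 (Sum.inr _) (Sum.inl _)] <;> ring

theorem comm_all_Lbd (A : Module.End ℂ R8)
    (hA : A ∈ ({Eh, Fh, Hh, Ev, Fv, Hv} : Set (Module.End ℂ R8))) (a b : Fin 2) (p : R8) :
    A (Lbd a b p) = Lbd a b (A p) := by
  simp only [Set.mem_insert_iff, Set.mem_singleton_iff] at hA
  rcases hA with rfl | rfl | rfl | rfl | rfl | rfl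
  · simp only [Eh_apply, Gd_Lbd]
  · simp only [Fh_apply, Gd_Lbd]
  · simp only [Hh_apply, Gd_Lbd, map_sub]
  · simp only [Ev_apply, Derivation.leibniz, Lbd_zeta, mul_zero, add_zero, smul_eq_mul]
  · exact Lbd_comm_Fv a b p
  · simp only [Hv_apply, Gd_Lbd, map_add, Derivation.map_smul]

/-- each of `E_h, F_h, H_h, E_v, F_v, H_v` commutes with every
`P_{αα̇}`, every `L_{αβ}` and every `L̄_{α̇β̇}`. -/
theorem stmt7 :
    ∀ A ∈ ({Eh, Fh, Hh, Ev, Fv, Hv} : Set (Module.End ℂ R8)),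
      (∀ a ad : Fin 2, A * Pop a ad = Pop a ad * A) ∧
      (∀ a b : Fin 2, A * Lop a b = Lop a b * A) ∧
      (∀ a b : Fin 2, A * Lbop a b = Lbop a b * A) := by
  intro A hA
  refine ⟨fun a b => LinearMap.ext fun p => ?_, fun a b => LinearMap.ext fun p => ?_,
    fun a b => LinearMap.ext fun p => ?_⟩
  · simp only [Module.End.mul_apply, Pop_apply, comm_all_Pd A hA]
  · simp only [Module.End.mul_apply, Lop_apply, comm_all_Ld A hA]
  · simp only [Module.End.mul_apply, Lbop_apply, comm_all_Lbd A hA]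

end
end
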